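/- arXiv:1903.07582 — 4 statements merged into one kernel-verified Lean document; each statement's English description precedes it below -/
import Mathlib

section
/- Let n be a positive integer and let C : ℝ → Matₙ(ℝ) be differentiable on an open interval J containing 0, satisfying the matrix Riccati equation C′(t) = C(t)² for all t ∈ J. Then for every t ∈ J one has the identity C(t) · (I − t·C(0)) = C(0); in particular, whenever I − t·C(0) is invertible, C(t) = C(0) · (I − t·C(0))⁻¹. -/
-- Entrywise sup norm on matrices, to speak of derivatives of matrix-valued functions.
attribute [local instance] Matrix.normedAddCommGroup Matrix.normedSpace

theorem riccati_aux {A : Type*} [NormedRing A] [NormedAlgebra ℝ A] (a b : ℝ) (ha : a < 0)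
    (hb : 0 < b) (c : ℝ → A) (hc : ∀ t ∈ Set.Ioo a b, HasDerivAt c (c t ^ 2) t) :
    ∀ t ∈ Set.Ioo a b, c t * (1 - t • c 0) = c 0 := by
  intro t ht
  obtain ⟨a', ha1, ha2⟩ := exists_between (lt_min ha ht.1)
  obtain ⟨b', hb1, hb2⟩ := exists_between (max_lt hb ht.2)
  have hsub : Set.Icc a' b' ⊆ Set.Ioo a b := fun x hx =>
    ⟨lt_of_lt_of_le ha1 hx.1, lt_of_le_of_lt hx.2 hb2⟩
  rw [lt_min_iff] at ha2
  rw [max_lt_iff] at hb1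
  have hcont : ContinuousOn c (Set.Icc a' b') := fun x hx =>
    (hc x (hsub hx)).continuousAt.continuousWithinAt
  obtain ⟨K, hK⟩ := isCompact_Icc.exists_bound_of_continuousOn hcont
  have key : Set.EqOn (fun s => c s * (1 - s • c 0) - c 0) (fun _ => 0) (Set.Ioo a' b') := by
    refine ODE_solution_unique_of_mem_Ioo (v := fun s x => c s * x) (s := fun _ => Set.univ)
      (K := K.toNNReal) (t₀ := 0) ?_ ⟨ha2.1, hb1.1⟩ ?_ ?_ ?_
    · intro s hs
      refine LipschitzOnWith.of_dist_le_mul fun x _ y _ => ?_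
      rw [dist_eq_norm, dist_eq_norm, ← mul_sub]
      refine (norm_mul_le _ _).trans ?_
      gcongr
      exact (hK s (Set.Ioo_subset_Icc_self hs)).trans (Real.le_coe_toNNReal K)
    · intro s hs
      refine ⟨?_, Set.mem_univ _⟩
      have h1 := hc s (hsub (Set.Ioo_subset_Icc_self hs))
      have h2 : HasDerivAt (fun s : ℝ => (1 : A) - s • c 0) (-((1 : ℝ) • c 0)) s :=
        ((hasDerivAt_id s).smul_const (c 0)).const_sub 1
      refine HasDerivAt.congr_deriv ((h1.mul h2).sub_const (c 0)) ?_
      rw [one_smul]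
      noncomm_ring
    · intro s hs
      refine ⟨?_, Set.mem_univ _⟩
      simpa using hasDerivAt_const s (0 : A)
    · simp
  exact sub_eq_zero.mp (key ⟨ha2.2, hb1.2⟩)

/-- Let `C : ℝ → Matₙ(ℝ)` be differentiable on an open interval
`J = (a, b)` containing `0` and satisfy the matrix Riccati equation `C' = C²` there.
Then for every `t ∈ J` one has `C t * (1 - t • C 0) = C 0`; in particular, whenever
`1 - t • C 0` is invertible, `C t = C 0 * (1 - t • C 0)⁻¹`. -/
theorem stmt1 (n : ℕ) (hn : 0 < n) (a b : ℝ) (ha : a < 0) (hb : 0 < b)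
    (C : ℝ → Matrix (Fin n) (Fin n) ℝ)
    (hC : ∀ t ∈ Set.Ioo a b, HasDerivAt C (C t ^ 2) t) :
    ∀ t ∈ Set.Ioo a b,
      C t * (1 - t • C 0) = C 0 ∧
      (IsUnit (1 - t • C 0) → C t = C 0 * (1 - t • C 0)⁻¹) := by
  intro t ht
  have h1 : C t * (1 - t • C 0) = C 0 := by
    let e := Matrix.toEuclideanCLM (n := Fin n) (𝕜 := ℝ)
    let L : Matrix (Fin n) (Fin n) ℝ →L[ℝ] _ := LinearMap.toContinuousLinearMap
      (e.toAlgEquiv.toLinearMap)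
    have hL : ∀ x, L x = e x := fun _ => rfl
    have h := riccati_aux a b ha hb (fun s => e (C s)) (fun s hs => by
      have := L.hasFDerivAt.comp_hasDerivAt s (hC s hs)
      have h2 : L (C s ^ 2) = e (C s) ^ 2 := (hL _).trans (map_pow e _ _)
      exact this.congr_deriv h2) t ht
    have hinj : Function.Injective e := EquivLike.injective e
    apply hinj
    rw [map_mul, map_sub, map_one, map_smul]
    exact h
  refine ⟨h1, fun hu => ?_⟩
  rw [Matrix.isUnit_iff_isUnit_det] at hu
  rw [← Matrix.mul_nonsing_inv_cancel_right _ (C t) hu, h1]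
end

section
/- Let n be a positive integer and let C : ℝ → Matₙ(ℝ) be differentiable on all of ℝ and satisfy the matrix Riccati equation C′(t) = C(t)² for every real t. Then every real eigenvalue of C(0) is zero; that is, if λ ∈ ℝ and there is a nonzero vector v ∈ ℝⁿ with C(0)·v = λ·v, then λ = 0. -/
/-- Let `C : ℝ → Matₙ(ℝ)` be differentiable on all of `ℝ` and satisfy the
matrix Riccati equation `C'(t) = C(t)²` for every real `t`.  Then every real eigenvalue of
`C 0` is zero: if `v ≠ 0` and `(C 0) ⬝ᵥ v = l • v` for some `l : ℝ`, then `l = 0`. -/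
theorem stmt2 (n : ℕ) (hn : 0 < n)
    (C : ℝ → Matrix (Fin n) (Fin n) ℝ)
    (hC : ∀ t : ℝ, HasDerivAt C (C t ^ 2) t)
    (l : ℝ) (v : Fin n → ℝ) (hv : v ≠ 0) (hev : (C 0).mulVec v = l • v) :
    l = 0 := by
  by_contra hl
  have hent : ∀ t i j, HasDerivAt (fun s => C s i j) ((C t ^ 2) i j) t := fun t i j =>
    hasDerivAt_pi.1 (hasDerivAt_pi.1 (hC t) i) j
  let D : ℝ → Fin n → Fin n → ℝ := fun t i j => C t i j
  have hcont : Continuous D := continuous_pi fun i => continuous_pi fun j =>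
    continuous_iff_continuousAt.2 fun t => (hent t i j).continuousAt
  have hmv : ∀ t, HasDerivAt (fun s => (C s).mulVec v) ((C t ^ 2).mulVec v) t := by
    intro t
    refine hasDerivAt_pi.2 fun i => ?_
    simp only [Matrix.mulVec, dotProduct]
    exact HasDerivAt.fun_sum fun j _ => (hent t i j).mul_const (v j)
  let w : ℝ → Fin n → ℝ := fun t => (1 - t * l) • (C t).mulVec v - l • v
  have hw : ∀ t, HasDerivAt w ((C t).mulVec (w t)) t := by
    intro t
    have h1 : HasDerivAt (fun s : ℝ => 1 - s * l) (-l) t := by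
      simpa using ((hasDerivAt_id t).mul_const l).const_sub 1
    have h2 := (h1.smul (hmv t)).sub_const (l • v)
    refine h2.congr_deriv ?_
    simp only [w, Matrix.mulVec_sub, Matrix.mulVec_smul, Matrix.mulVec_mulVec, pow_two]
    module
  have hw0 : w 0 = 0 := by simp [w, hev]
  have hwT : w (1 / l) = -(l • v) := by simp [w, hl]
  obtain ⟨K, hK⟩ := (isCompact_Icc (a := -(|1 / l| + 1)) (b := |1 / l| + 1)).exists_bound_of_continuousOn
    hcont.continuousOn
  have hlip : ∀ t ∈ Set.Icc (-(|1 / l| + 1)) (|1 / l| + 1),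
      LipschitzWith (Real.toNNReal (n * K)) (fun x => (C t).mulVec x) := by
    intro t ht
    have hKt : ‖D t‖ ≤ K := hK t ht
    have hK0 : 0 ≤ K := (norm_nonneg _).trans hKt
    refine LipschitzWith.of_dist_le_mul fun x y => ?_
    rw [dist_eq_norm, dist_eq_norm, ← Matrix.mulVec_sub, Real.coe_toNNReal _ (by positivity)]
    refine (pi_norm_le_iff_of_nonneg (by positivity)).2 fun i => ?_
    calc ‖(C t).mulVec (x - y) i‖ ≤ ∑ j, ‖C t i j * (x - y) j‖ := by
          simp only [Matrix.mulVec, dotProduct]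
          exact norm_sum_le _ _
      _ ≤ ∑ j : Fin n, K * ‖x - y‖ := by
          refine Finset.sum_le_sum fun j _ => ?_
          rw [norm_mul]
          exact mul_le_mul (((norm_le_pi_norm (D t i) j).trans (norm_le_pi_norm (D t) i)).trans hKt)
            (norm_le_pi_norm (x - y) j) (norm_nonneg _) hK0
      _ = n * K * ‖x - y‖ := by simp; ring
  have hcw : Continuous w := continuous_iff_continuousAt.2 fun t => (hw t).continuousAt
  have hpos := abs_nonneg (1 / l)
  have key := ODE_solution_unique_of_mem_Icc (v := fun t x => (C t).mulVec x)
    (s := fun _ => Set.univ) (f := w) (g := fun _ => 0) (t₀ := 0)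
    (fun t ht => (hlip t (Set.Ioo_subset_Icc_self ht)).lipschitzOnWith)
    ⟨by linarith, by linarith⟩
    hcw.continuousOn (fun t _ => hw t) (fun _ _ => Set.mem_univ _)
    continuousOn_const (fun t _ => by simpa using hasDerivAt_const t (0 : Fin n → ℝ))
    (fun _ _ => Set.mem_univ _) hw0
  have hmem : 1 / l ∈ Set.Icc (-(|1 / l| + 1)) (|1 / l| + 1) :=
    ⟨by linarith [neg_abs_le (1 / l)], by linarith [le_abs_self (1 / l)]⟩
  have := key hmem
  rw [hwT] at this
  simp [hl, hv] at this
end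

section
/- Let A₀ be a nonzero 2×2 real matrix with (trace A₀)² < 4·det A₀, and for t ∈ ℝ set A(t) = A₀ · (I − t·A₀)⁻¹ (which is defined for all real t). Then det A(t) → 0 and trace A(t) → 0 as t → +∞, and there exists t₀ ∈ ℝ such that trace A(t) ≤ 0 for all t ≥ t₀. -/
/-- Let `A₀` be a nonzero `2 × 2` real matrix with
`(trace A₀)² < 4 · det A₀`, and for `t : ℝ` set `A t = A₀ * (1 - t • A₀)⁻¹` (which is
defined for all real `t`).  Then `det (A t) → 0` and `trace (A t) → 0` as `t → +∞`, and
there is `t₀ : ℝ` such that `trace (A t) ≤ 0` for all `t ≥ t₀`. -/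
theorem stmt8 (A₀ : Matrix (Fin 2) (Fin 2) ℝ) (hA₀ : A₀ ≠ 0)
    (h : A₀.trace ^ 2 < 4 * A₀.det)
    (A : ℝ → Matrix (Fin 2) (Fin 2) ℝ)
    (hA : ∀ t : ℝ, A t = A₀ * (1 - t • A₀)⁻¹) :
    Filter.Tendsto (fun t => (A t).det) Filter.atTop (nhds 0) ∧
    Filter.Tendsto (fun t => (A t).trace) Filter.atTop (nhds 0) ∧
    ∃ t₀ : ℝ, ∀ t ≥ t₀, (A t).trace ≤ 0 := by
  obtain ⟨T, hT⟩ : ∃ T, T = A₀.trace := ⟨_, rfl⟩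
  obtain ⟨d, hd⟩ : ∃ d, d = A₀.det := ⟨_, rfl⟩
  rw [← hT, ← hd] at h
  have hd0 : 0 < d := by nlinarith [sq_nonneg T]
  have hq : ∀ t : ℝ, 0 < 1 - t * T + t ^ 2 * d := by
    intro t
    nlinarith [sq_nonneg (2 * d * t - T), sq_nonneg t]
  have hdet1 : ∀ t : ℝ, (1 - t • A₀).det = 1 - t * T + t ^ 2 * d := by
    intro t
    rw [hT, hd, Matrix.det_fin_two, Matrix.det_fin_two, Matrix.trace_fin_two]
    simp
    ring
  have hdet : ∀ t : ℝ, (A t).det = d / (1 - t * T + t ^ 2 * d) := by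
    intro t
    rw [hA, Matrix.det_mul, Matrix.det_nonsing_inv, hdet1, ← hd, Ring.inverse_eq_inv',
      div_eq_mul_inv]
  have htr : ∀ t : ℝ, (A t).trace = (T - 2 * t * d) / (1 - t * T + t ^ 2 * d) := by
    intro t
    rw [hA, Matrix.inv_def, hdet1, Ring.inverse_eq_inv', Matrix.mul_smul, Matrix.trace_smul,
      div_eq_inv_mul, smul_eq_mul]
    congr 1
    rw [hT, hd, Matrix.det_fin_two, Matrix.trace_fin_two, Matrix.trace_fin_two,
      Matrix.adjugate_fin_two]
    simp [Matrix.mul_apply, Fin.sum_univ_two]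
    ring
  have hinv : Filter.Tendsto (fun t : ℝ => t⁻¹) Filter.atTop (nhds 0) := tendsto_inv_atTop_zero
  refine ⟨?_, ?_, T / (2 * d), ?_⟩
  · have hc : ContinuousAt (fun s : ℝ => d * s ^ 2 / (s ^ 2 - s * T + d)) 0 := by
      apply ContinuousAt.div (by fun_prop) (by fun_prop)
      simpa using hd0.ne'
    have hc' := hc.tendsto.comp hinv
    simp only [ne_eq, OfNat.ofNat_ne_zero, not_false_eq_true, zero_pow, mul_zero, zero_div] at hc'
    refine hc'.congr' ?_
    filter_upwards [Filter.eventually_gt_atTop 0] with t ht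
    have := hq t
    have e : t⁻¹ ^ 2 - t⁻¹ * T + d = (1 - t * T + t ^ 2 * d) * t⁻¹ ^ 2 := by
      field_simp
    simp only [Function.comp]
    rw [hdet, e, mul_div_mul_right _ _ (by positivity)]
  · have hc : ContinuousAt (fun s : ℝ => (T * s ^ 2 - 2 * d * s) / (s ^ 2 - s * T + d)) 0 := by
      apply ContinuousAt.div (by fun_prop) (by fun_prop)
      simpa using hd0.ne'
    have hc' := hc.tendsto.comp hinv
    simp only [ne_eq, OfNat.ofNat_ne_zero, not_false_eq_true, zero_pow, mul_zero, zero_div,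
      sub_zero] at hc'
    refine hc'.congr' ?_
    filter_upwards [Filter.eventually_gt_atTop 0] with t ht
    have := hq t
    have e : t⁻¹ ^ 2 - t⁻¹ * T + d = (1 - t * T + t ^ 2 * d) * t⁻¹ ^ 2 := by
      field_simp
    have e2 : T * t⁻¹ ^ 2 - 2 * d * t⁻¹ = (T - 2 * t * d) * t⁻¹ ^ 2 := by
      field_simp
    simp only [Function.comp]
    rw [htr, e, e2, mul_div_mul_right _ _ (by positivity)]
  · intro t ht
    rw [htr]
    apply div_nonpos_of_nonpos_of_nonneg _ (hq t).le
    rw [ge_iff_le, div_le_iff₀ (by positivity)] at ht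
    linarith
end

section
/- Let X be a metric space equipped with a finite Borel measure μ that is positive on every nonempty open set, and suppose X is second countable. Let T : X → X be a measurable map preserving μ. Let f, g : X → ℝ be continuous functions with f(T x) = f(x) + g(x) for all x, g(T x) = g(x) for all x, and g(x) ≥ 0 for all x. Then g(x) = 0 for every x ∈ X. (Along the orbit of any point x one has f(Tⁿ x) = f(x) + n·g(x), so f grows linearly unless g vanishes; Poincaré recurrence for the finite-measure-preserving map T forces g ≡ 0.) -/
open MeasureTheory

/-- Let `X` be a second countable metric space with a finite Borel
measure `μ` which is positive on every nonempty open set, and let `T : X → X` be a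
measure-preserving map.  If `f g : X → ℝ` are continuous with `f (T x) = f x + g x`,
`g (T x) = g x` and `g x ≥ 0` for all `x`, then `g ≡ 0`.  (Along orbits
`f (Tⁿ x) = f x + n • g x`, so `f` grows linearly unless `g` vanishes; Poincaré recurrence
forces `g ≡ 0`.) -/
theorem stmt14 {X : Type*} [MetricSpace X] [SecondCountableTopology X]
    [MeasurableSpace X] [BorelSpace X]
    (μ : Measure X) [IsFiniteMeasure μ]
    (hμ : ∀ U : Set X, IsOpen U → U.Nonempty → 0 < μ U)
    (T : X → X) (hT : MeasurePreserving T μ μ)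
    (f g : X → ℝ) (hf : Continuous f) (hg : Continuous g)
    (hfT : ∀ x, f (T x) = f x + g x)
    (hgT : ∀ x, g (T x) = g x)
    (hg0 : ∀ x, 0 ≤ g x) :
    ∀ x, g x = 0 := by
  intro x₀
  by_contra hne
  have hc : 0 < g x₀ := lt_of_le_of_ne (hg0 x₀) (Ne.symm hne)
  have hit : ∀ (n : ℕ) (x : X), f (T^[n] x) = f x + n * g x ∧ g (T^[n] x) = g x := by
    intro n x
    induction n with
    | zero => simp
    | succ k ih =>
      rw [Function.iterate_succ_apply', hfT, hgT, ih.1, ih.2]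
      refine ⟨?_, rfl⟩
      push_cast
      ring
  let U : Set X := {x | g x₀ / 2 < g x} ∩ ({x | f x₀ - g x₀ / 4 < f x} ∩ {x | f x < f x₀ + g x₀ / 4})
  have hU : IsOpen U := (isOpen_lt continuous_const hg).inter
    ((isOpen_lt continuous_const hf).inter (isOpen_lt hf continuous_const))
  have hx₀ : x₀ ∈ U := by
    refine ⟨?_, ?_, ?_⟩ <;> simp only [Set.mem_setOf_eq] <;> linarith
  obtain ⟨x, ⟨h1, h2, h3⟩, m, hm, ⟨h4, h5, h6⟩⟩ :=
    hT.conservative.exists_mem_iterate_mem hU.measurableSet.nullMeasurableSet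
      (hμ U hU ⟨x₀, hx₀⟩).ne'
  simp only [Set.mem_setOf_eq] at h1 h2 h3 h4 h5 h6
  rw [(hit m x).1] at h6
  have hm1 : (1 : ℝ) ≤ m := by exact_mod_cast Nat.one_le_iff_ne_zero.mpr hm
  have := mul_le_mul_of_nonneg_right hm1 (hg0 x)
  linarith
end
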